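/- Let η ≥ 1, let R be an η×η real positive definite matrix, P_D ∈ (0,1), β_FP > 0, and let D, M be natural numbers. Suppose a track receives D detections and M misses in a single frame, where the i-th detection (i = 1,…,D) contributes ΔL_{h,i} = log( P_D / ((2π)^{η/2} β_FP √(det S_i)) ) − d_i²/2 with S_i = A_i + R for some positive semidefinite A_i and d_i² = ỹ_iᵀ S_i⁻¹ ỹ_i for some ỹ_i ∈ ℝ^η, and each miss contributes ΔL_m = log(1 − P_D). Then the total change in track score ΔL = Σ_{i=1}^{D} ΔL_{h,i} + M · log(1 − P_D) satisfies ΔL ≤ D · log( P_D / ((2π)^{η/2} β_FP √(det R)) ) + M · log(1 − P_D). (Proposition 2.) -/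

import Mathlib

open Real Matrix

/-- The determinant of `1 + P` is at least one for `P` positive semidefinite. -/
theorem Matrix.PosSemidef.one_le_det_one_add {n : Type*} [Fintype n] [DecidableEq n]
    {P : Matrix n n ℝ} (hP : P.PosSemidef) : 1 ≤ (1 + P).det := by
  have h : (1 + P).det = ∏ i, (1 + hP.isHermitian.eigenvalues i) := by
    have key := congrArg (Polynomial.eval (-1)) hP.isHermitian.charpoly_eq
    rw [Matrix.eval_charpoly, Polynomial.eval_prod] at key
    have hneg : Matrix.scalar n (-1 : ℝ) - P = -(1 + P) := by
      simp only [map_neg, map_one]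
      abel
    have hfac : ∀ i, Polynomial.eval (-1 : ℝ)
        (Polynomial.X - Polynomial.C (hP.isHermitian.eigenvalues i))
          = -1 * (1 + hP.isHermitian.eigenvalues i) := fun i => by
      simp only [Polynomial.eval_sub, Polynomial.eval_X, Polynomial.eval_C]
      ring
    rw [hneg, Matrix.det_neg] at key
    simp only [RCLike.ofReal_real_eq_id, id_eq, hfac, Finset.prod_mul_distrib,
      Finset.prod_const, Finset.card_univ] at key
    exact mul_left_cancel₀ (pow_ne_zero _ (by norm_num)) key
  rw [h]
  exact Finset.one_le_prod fun i _ => by linarith [hP.eigenvalues_nonneg i]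

open scoped MatrixOrder in
/-- Adding a positive semidefinite matrix to a positive definite one does not decrease
the determinant. -/
theorem Matrix.PosDef.det_le_det_add {n : Type*} [Fintype n] [DecidableEq n]
    {R A : Matrix n n ℝ} (hR : R.PosDef) (hA : A.PosSemidef) : R.det ≤ (A + R).det := by
  obtain ⟨B, rfl⟩ := CStarAlgebra.nonneg_iff_eq_star_mul_self.mp hA.nonneg
  rw [add_comm, Matrix.det_add_mul _ _ hR.det_pos.ne'.isUnit]
  refine le_mul_of_one_le_right hR.det_pos.le ?_
  exact (hR.inv.posSemidef.mul_mul_conjTranspose_same B).one_le_det_one_add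

/-- Proposition 2: With `D` detections (the `i`-th having
innovation covariance `S_i = A_i + R`, `A_i` positive semidefinite, and
normalized innovation `d_i² = ỹ_iᵀ S_i⁻¹ ỹ_i`) and `M` misses, the total
change in track score
`ΔL = Σ_i [ log(P_D / ((2π)^{η/2} β_FP √(det S_i))) − d_i²/2 ] + M·log(1 − P_D)`
satisfies
`ΔL ≤ D·log(P_D / ((2π)^{η/2} β_FP √(det R))) + M·log(1 − P_D)`. -/
theorem frame_score_change_le_bound
    (η : ℕ) (hη : 1 ≤ η)
    (R : Matrix (Fin η) (Fin η) ℝ) (hR : R.PosDef)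
    (P_D β_FP : ℝ) (hPD : P_D ∈ Set.Ioo (0 : ℝ) 1) (hβ : 0 < β_FP)
    (D M : ℕ)
    (A : Fin D → Matrix (Fin η) (Fin η) ℝ) (hA : ∀ i, (A i).PosSemidef)
    (S : Fin D → Matrix (Fin η) (Fin η) ℝ) (hS : ∀ i, S i = A i + R)
    (y : Fin D → (Fin η → ℝ))
    (d2 : Fin D → ℝ) (hd2 : ∀ i, d2 i = y i ⬝ᵥ ((S i)⁻¹ *ᵥ y i))
    (ΔL : ℝ)
    (hΔL : ΔL =
      (∑ i : Fin D,
        (Real.log (P_D / ((2 * Real.pi) ^ ((η : ℝ) / 2) * β_FP * Real.sqrt (S i).det))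
          - d2 i / 2))
      + (M : ℝ) * Real.log (1 - P_D)) :
    ΔL ≤ (D : ℝ) *
        Real.log (P_D / ((2 * Real.pi) ^ ((η : ℝ) / 2) * β_FP * Real.sqrt R.det))
      + (M : ℝ) * Real.log (1 - P_D) := by
  rw [hΔL]
  gcongr
  have hbound : ∀ i ∈ (Finset.univ : Finset (Fin D)),
      Real.log (P_D / ((2 * Real.pi) ^ ((η : ℝ) / 2) * β_FP * Real.sqrt (S i).det)) - d2 i / 2
        ≤ Real.log (P_D / ((2 * Real.pi) ^ ((η : ℝ) / 2) * β_FP * Real.sqrt R.det)) := by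
    intro i _
    have hSi : (S i).PosDef := hS i ▸ Matrix.PosDef.posSemidef_add (hA i) hR
    have hd : 0 ≤ d2 i := by
      simpa [hd2 i] using hSi.inv.posSemidef.dotProduct_mulVec_nonneg (y i)
    have hdet : R.det ≤ (S i).det := hS i ▸ hR.det_le_det_add (hA i)
    have hPD0 := hPD.1
    have hRdet := hR.det_pos
    have hSdet := hSi.det_pos
    have hlog : Real.log (P_D / ((2 * Real.pi) ^ ((η : ℝ) / 2) * β_FP * Real.sqrt (S i).det))
        ≤ Real.log (P_D / ((2 * Real.pi) ^ ((η : ℝ) / 2) * β_FP * Real.sqrt R.det)) := by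
      gcongr
    linarith
  simpa using Finset.sum_le_sum hbound
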